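/- arXiv:2505.11650 — 2 statements merged into one kernel-verified Lean document; each statement's English description precedes it below -/
import Mathlib

section
/- Let F, h₀ : ℝ² → ℝ be differentiable on ℝ² \ {0} and 0-homogeneous (invariant under multiplication of the argument by positive scalars), with 1 + h₀(x) > 0 for all x ≠ 0, and define Γ(x) := (1 + h₀(x)) x. Then for every x on the unit circle (|x| = 1), the gradient of F at the deformed point satisfies ∇F(Γ(x)) = (1 + h₀(x))⁻¹ · ∇(F∘Γ)(x). -/
/-- For 0-homogeneous `F`, `h₀`, differentiable away from 0, with `1 + h₀ > 0`,
and `Γ(x) = (1 + h₀(x)) x`, at every point of the unit circle one has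
`∇F(Γ(x)) = (1 + h₀(x))⁻¹ ∇(F∘Γ)(x)`. -/
theorem stmt_6 (F h₀ : EuclideanSpace ℝ (Fin 2) → ℝ)
    (hF : DifferentiableOn ℝ F {0}ᶜ)
    (hh : DifferentiableOn ℝ h₀ {0}ᶜ)
    (hFhom : ∀ l : ℝ, 0 < l → ∀ x : EuclideanSpace ℝ (Fin 2), x ≠ 0 → F (l • x) = F x)
    (hhhom : ∀ l : ℝ, 0 < l → ∀ x : EuclideanSpace ℝ (Fin 2), x ≠ 0 → h₀ (l • x) = h₀ x)
    (hpos : ∀ x : EuclideanSpace ℝ (Fin 2), x ≠ 0 → 0 < 1 + h₀ x)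
    (Γ : EuclideanSpace ℝ (Fin 2) → EuclideanSpace ℝ (Fin 2))
    (hΓ : ∀ x, Γ x = (1 + h₀ x) • x) :
    ∀ x : EuclideanSpace ℝ (Fin 2), ‖x‖ = 1 →
      gradient F (Γ x) = (1 + h₀ x)⁻¹ • gradient (F ∘ Γ) x := by
  intro x hx
  have hx0 : x ≠ 0 := norm_ne_zero_iff.mp (by simp [hx])
  have hnear : ∀ᶠ y in nhds x, y ≠ 0 := isOpen_ne.mem_nhds hx0
  have hcomp : F ∘ Γ =ᶠ[nhds x] F := hnear.mono fun y hy => by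
    simp only [Function.comp_apply, hΓ, hFhom _ (hpos y hy) y hy]
  have hscale : (fun y => F ((1 + h₀ x) • y)) =ᶠ[nhds x] F :=
    hnear.mono fun y hy => hFhom _ (hpos x hx0) y hy
  have hderiv : (1 + h₀ x) • fderiv ℝ F ((1 + h₀ x) • x) = fderiv ℝ F x := by
    rw [← fderiv_comp_smul, hscale.fderiv_eq]
  rw [gradient, gradient, hcomp.fderiv_eq, hΓ, ← hderiv, map_smulₛₗ]
  simp [smul_smul, (hpos x hx0).ne']
end

section
/- Let ξ, ξ̂ : ℝ → ℝ be twice continuously differentiable and 2π-periodic, and for ε ∈ ℝ define P(ε) := ∫₀^{2π} e^{ξ(θ)+ε ξ̂(θ)} √(1 + (ξ'(θ) + ε ξ̂'(θ))²) dθ. Then P is differentiable at ε = 0 and P'(0) = ∫₀^{2π} [ e^{ξ(θ)} √(1 + ξ'(θ)²) − d/dθ ( e^{ξ(θ)} ξ'(θ) (1 + ξ'(θ)²)^{-1/2} ) ] ξ̂(θ) dθ. -/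
open Real

/-- Differentiation under the integral sign over a compact interval, for an integrand whose
derivative in the parameter is jointly continuous. -/
lemma hasDerivAt_intervalIntegral_of_continuous_deriv {F F' : ℝ → ℝ → ℝ} {a b x₀ : ℝ}
    (hF : ∀ x, Continuous (F x)) (hF' : Continuous (Function.uncurry F'))
    (hd : ∀ x t, HasDerivAt (fun x => F x t) (F' x t) x) :
    HasDerivAt (fun x => ∫ t in a..b, F x t) (∫ t in a..b, F' x₀ t) x₀ := by
  obtain ⟨C, hC⟩ := ((isCompact_closedBall x₀ 1).prod
    (isCompact_uIcc (a := a) (b := b))).exists_bound_of_continuousOn hF'.continuousOn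
  have hF'x₀ : Continuous (F' x₀) := hF'.comp (Continuous.prodMk_right x₀)
  refine (intervalIntegral.hasDerivAt_integral_of_dominated_loc_of_deriv_le
    (bound := fun _ => C) (Metric.closedBall_mem_nhds x₀ one_pos)
    (.of_forall fun x => (hF x).aestronglyMeasurable) ((hF x₀).intervalIntegrable a b)
    hF'x₀.aestronglyMeasurable
    (.of_forall fun t ht x hx => hC (x, t) ⟨hx, Set.uIoc_subset_uIcc ht⟩)
    intervalIntegrable_const (.of_forall fun t _ x _ => hd x t)).2

/-- Integration by parts for periodic functions over a period: the boundary terms cancel. -/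
lemma integral_mul_deriv_eq_neg_of_periodic {u v : ℝ → ℝ} {T : ℝ}
    (hu : ContDiff ℝ 1 u) (hv : ContDiff ℝ 1 v)
    (hup : Function.Periodic u T) (hvp : Function.Periodic v T) :
    ∫ x in (0 : ℝ)..T, u x * deriv v x = -∫ x in (0 : ℝ)..T, deriv u x * v x := by
  rw [intervalIntegral.integral_mul_deriv_eq_deriv_mul
    (fun x _ => (hu.differentiable one_ne_zero x).hasDerivAt)
    (fun x _ => (hv.differentiable one_ne_zero x).hasDerivAt)
    ((hu.continuous_deriv le_rfl).intervalIntegrable _ _)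
    ((hv.continuous_deriv le_rfl).intervalIntegrable _ _), hup.eq, hvp.eq]
  ring

lemma hasDerivAt_exp_mul_sqrt_one_add_sq_affine (a b c d x : ℝ) :
    HasDerivAt (fun x => exp (a + x * b) * √(1 + (c + x * d) ^ 2))
      (exp (a + x * b) * b * √(1 + (c + x * d) ^ 2)
        + exp (a + x * b) * ((c + x * d) * (√(1 + (c + x * d) ^ 2))⁻¹ * d)) x := by
  have h1 : HasDerivAt (fun x => a + x * b) b x := by
    simpa using ((hasDerivAt_id x).mul_const b).const_add a
  have h2 : HasDerivAt (fun x => c + x * d) d x := by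
    simpa using ((hasDerivAt_id x).mul_const d).const_add c
  have h3 : 0 < 1 + (c + x * d) ^ 2 := by positivity
  have h4 := (Real.sqrt_pos.2 h3).ne'
  refine (h1.exp.mul (((h2.pow 2).const_add 1).sqrt h3.ne')).congr_deriv ?_
  simp only [Pi.pow_apply]
  field_simp
  norm_num
  ring

theorem stmt_11 (ξ ξh : ℝ → ℝ) (hξ : ContDiff ℝ 2 ξ) (hξh : ContDiff ℝ 2 ξh)
    (hξp : ∀ θ, ξ (θ + 2 * π) = ξ θ) (hξhp : ∀ θ, ξh (θ + 2 * π) = ξh θ)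
    (P : ℝ → ℝ)
    (hP : ∀ ε, P ε = ∫ θ in (0 : ℝ)..(2 * π),
        exp (ξ θ + ε * ξh θ) * Real.sqrt (1 + (deriv ξ θ + ε * deriv ξh θ) ^ 2)) :
    HasDerivAt P
      (∫ θ in (0 : ℝ)..(2 * π),
        (exp (ξ θ) * Real.sqrt (1 + deriv ξ θ ^ 2)
          - deriv (fun t => exp (ξ t) * deriv ξ t * (Real.sqrt (1 + deriv ξ t ^ 2))⁻¹) θ)
          * ξh θ)
      0 := by
  have hξ' : ContDiff ℝ 1 (deriv ξ) := ((contDiff_succ_iff_deriv (n := 1)).1 hξ).2.2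
  have hξh' : ContDiff ℝ 1 (deriv ξh) := ((contDiff_succ_iff_deriv (n := 1)).1 hξh).2.2
  have hξ₁ : ContDiff ℝ 1 ξ := hξ.of_le one_le_two
  have hξh₁ : ContDiff ℝ 1 ξh := hξh.of_le one_le_two
  have cξ := hξ.continuous
  have cξh := hξh.continuous
  have cξ' := hξ'.continuous
  have cξh' := hξh'.continuous
  have hξp' : Function.Periodic (deriv ξ) (2 * π) := fun θ => by
    rw [← deriv_comp_add_const, funext hξp]
  set u : ℝ → ℝ := fun t => exp (ξ t) * deriv ξ t * (√(1 + deriv ξ t ^ 2))⁻¹ with hu_def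
  have hu : ContDiff ℝ 1 u := by
    have hpos : ∀ t, 0 < 1 + deriv ξ t ^ 2 := fun t => by positivity
    exact (hξ₁.exp.mul hξ').mul (((contDiff_const.add (hξ'.pow 2)).sqrt
      fun t => (hpos t).ne').inv fun t => (Real.sqrt_pos.2 (hpos t)).ne')
  have hup : Function.Periodic u (2 * π) := fun θ => by simp only [hu_def, hξp θ, hξp' θ]
  have cu := hu.continuous
  have cu' := hu.continuous_deriv le_rfl
  have hcont : Continuous (Function.uncurry fun ε θ =>
      exp (ξ θ + ε * ξh θ) * ξh θ * √(1 + (deriv ξ θ + ε * deriv ξh θ) ^ 2)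
        + exp (ξ θ + ε * ξh θ) * ((deriv ξ θ + ε * deriv ξh θ)
          * (√(1 + (deriv ξ θ + ε * deriv ξh θ) ^ 2))⁻¹ * deriv ξh θ)) := by
    have hinv : Continuous fun p : ℝ × ℝ =>
        (√(1 + (deriv ξ p.2 + p.1 * deriv ξh p.2) ^ 2))⁻¹ :=
      Continuous.inv₀ (by fun_prop) fun p => (Real.sqrt_pos.2 (by positivity)).ne'
    simp only [Function.uncurry_def]
    fun_prop
  rw [funext hP]
  convert hasDerivAt_intervalIntegral_of_continuous_deriv
    (F := fun ε θ => exp (ξ θ + ε * ξh θ) * √(1 + (deriv ξ θ + ε * deriv ξh θ) ^ 2)) (a := 0) (b := 2 * π) (x₀ := 0)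
    (fun ε => by fun_prop) hcont
    (fun ε θ => hasDerivAt_exp_mul_sqrt_one_add_sq_affine _ _ _ _ ε) using 1
  calc
    _ = (∫ θ in (0 : ℝ)..(2 * π), exp (ξ θ) * √(1 + deriv ξ θ ^ 2) * ξh θ)
        - ∫ θ in (0 : ℝ)..(2 * π), deriv u θ * ξh θ := by
      rw [← intervalIntegral.integral_sub
        (Continuous.intervalIntegrable (by fun_prop) _ _)
        (Continuous.intervalIntegrable (by fun_prop) _ _)]
      simp only [sub_mul]
    _ = (∫ θ in (0 : ℝ)..(2 * π), exp (ξ θ) * √(1 + deriv ξ θ ^ 2) * ξh θ)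
        + ∫ θ in (0 : ℝ)..(2 * π), u θ * deriv ξh θ := by
      rw [integral_mul_deriv_eq_neg_of_periodic hu hξh₁ hup hξhp, sub_eq_add_neg]
    _ = _ := by
      rw [← intervalIntegral.integral_add
        (Continuous.intervalIntegrable (by fun_prop) _ _)
        (Continuous.intervalIntegrable (by fun_prop) _ _)]
      refine intervalIntegral.integral_congr fun θ _ => ?_
      simp only [hu_def, zero_mul, add_zero]
      ring
end
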